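/- Let g ∈ C_c^∞(ℝ^d) and suppose u ∈ C³(ℝ^d) satisfies the Poisson equation u(x) − Δu(x) + ⟨∇U(x), ∇u(x)⟩ = g(x) for all x ∈ ℝ^d, together with the a priori bounds ∫ u² dπ ≤ ∫ g² dπ and ∫ |∇u|² dπ ≤ ∫ g² dπ. Then the (a priori possibly infinite) integral of the squared Frobenius norm of the Hessian satisfies ∫ ‖∇²u(x)‖_F² dπ(x) ≤ 2(2 + c_U) ∫ g(x)² dπ(x); in particular it is finite. -/

import Mathlib

open MeasureTheory Real
open scoped RealInnerProductSpace

/-- The Laplacian of `U`, defined as the sum of second partial derivatives. -/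
noncomputable def lapl (d : ℕ) (U : EuclideanSpace ℝ (Fin d) → ℝ)
    (x : EuclideanSpace ℝ (Fin d)) : ℝ :=
  ∑ i : Fin d,
    fderiv ℝ (fun y => fderiv ℝ U y (EuclideanSpace.single i 1)) x (EuclideanSpace.single i 1)

/-- The Gibbs probability measure `π` with density `Z⁻¹ e^{-U}` w.r.t. Lebesgue measure. -/
noncomputable def gibbs (d : ℕ) (U : EuclideanSpace ℝ (Fin d) → ℝ) (Z : ℝ) :
    Measure (EuclideanSpace ℝ (Fin d)) :=
  volume.withDensity (fun x => ENNReal.ofReal (Real.exp (-U x) / Z))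

/-- Squared Frobenius norm of the Hessian of `u`. -/
noncomputable def hessFS (d : ℕ) (u : EuclideanSpace ℝ (Fin d) → ℝ)
    (x : EuclideanSpace ℝ (Fin d)) : ℝ :=
  ∑ i : Fin d, ∑ j : Fin d,
    (fderiv ℝ (fun y => fderiv ℝ u y (EuclideanSpace.single j 1)) x
      (EuclideanSpace.single i 1)) ^ 2

/-- Divergence of a vector field `F`. -/
noncomputable def diverg (d : ℕ)
    (F : EuclideanSpace ℝ (Fin d) → EuclideanSpace ℝ (Fin d))
    (x : EuclideanSpace ℝ (Fin d)) : ℝ :=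
  ∑ i : Fin d, fderiv ℝ (fun y => F y i) x (EuclideanSpace.single i 1)


/-- Partial derivative in direction `i`. -/
noncomputable def pd {d : ℕ} (i : Fin d) (f : EuclideanSpace ℝ (Fin d) → ℝ)
    (x : EuclideanSpace ℝ (Fin d)) : ℝ := fderiv ℝ f x (EuclideanSpace.single i 1)

lemma pd_contDiff {d : ℕ} (i : Fin d) {f : EuclideanSpace ℝ (Fin d) → ℝ} {m n : WithTop ℕ∞}
    (hf : ContDiff ℝ n f) (h : m + 1 ≤ n) : ContDiff ℝ m (pd i f) :=
  (hf.fderiv_right h).clm_apply contDiff_const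

lemma pd_symm {d : ℕ} (i j : Fin d) {f : EuclideanSpace ℝ (Fin d) → ℝ}
    (hf : ContDiff ℝ 2 f) : pd i (pd j f) = pd j (pd i f) := by
  funext x
  have hs : IsSymmSndFDerivAt ℝ f x := hf.contDiffAt.isSymmSndFDerivAt (by simp)
  have hd : DifferentiableAt ℝ (fderiv ℝ f) x :=
    ((hf.fderiv_right (m := 1) (by norm_num)).differentiable (by norm_num)) x
  have key : ∀ a b : Fin d, pd a (pd b f) x =
      fderiv ℝ (fderiv ℝ f) x (EuclideanSpace.single a 1) (EuclideanSpace.single b 1) := by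
    intro a b
    change fderiv ℝ (fun y => fderiv ℝ f y (EuclideanSpace.single b 1)) x _ = _
    rw [fderiv_clm_apply hd (differentiableAt_const _)]
    simp
  rw [key, key, hs]

lemma pd_mul {d : ℕ} (i : Fin d) {f g : EuclideanSpace ℝ (Fin d) → ℝ}
    (hf : ContDiff ℝ 1 f) (hg : ContDiff ℝ 1 g) (x) :
    pd i (fun y => f y * g y) x = pd i f x * g x + f x * pd i g x := by
  have h1 := (hf.differentiable (by norm_num)) x
  have h2 := (hg.differentiable (by norm_num)) x
  unfold pd
  rw [fderiv_fun_mul h1 h2]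
  simp; ring

lemma pd_integral {d : ℕ} (i : Fin d) {f : EuclideanSpace ℝ (Fin d) → ℝ}
    (hf : ContDiff ℝ 1 f) (hc : HasCompactSupport f) :
    Integrable (pd i f) ∧ ∫ x, pd i f x = 0 := by
  have hi : Integrable (pd i f) :=
    (pd_contDiff i (m := 0) hf (by norm_num)).continuous.integrable_of_hasCompactSupport
      (hc.fderiv_apply ℝ _)
  refine ⟨hi, ?_⟩
  have := integral_mul_fderiv_eq_neg_fderiv_mul_of_integrable (μ := (volume : Measure (EuclideanSpace ℝ (Fin d))))
    (f := fun _ => (1 : ℝ)) (g := f)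
    (v := EuclideanSpace.single i 1) (by simp) (by simp only [one_mul]; exact hi)
    (by simpa using hf.continuous.integrable_of_hasCompactSupport hc)
    (by simp) (fun x _ => hf.differentiable (by norm_num) x)
  simpa [pd] using this

lemma inner_grad {d : ℕ} (f g : EuclideanSpace ℝ (Fin d) → ℝ) (x) :
    ⟪gradient f x, gradient g x⟫ = ∑ i, pd i f x * pd i g x := by
  rw [← OrthonormalBasis.sum_inner_mul_inner (EuclideanSpace.basisFun (Fin d) ℝ)]
  refine Finset.sum_congr rfl fun i _ => ?_
  rw [inner_gradient_left, real_inner_comm, inner_gradient_left]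
  simp [pd]

lemma norm_grad {d : ℕ} (f : EuclideanSpace ℝ (Fin d) → ℝ) (x) :
    ‖gradient f x‖ ^ 2 = ∑ i, pd i f x ^ 2 := by
  rw [← real_inner_self_eq_norm_sq, inner_grad]
  simp [sq]

lemma fderiv_eq_sum {d : ℕ} (f g : EuclideanSpace ℝ (Fin d) → ℝ) (x z) :
    fderiv ℝ f z (gradient g x) = ∑ i, pd i g x * pd i f z := by
  have h : gradient g x = ∑ i, pd i g x • EuclideanSpace.single i (1:ℝ) := by
    conv_lhs => rw [← OrthonormalBasis.sum_repr (EuclideanSpace.basisFun (Fin d) ℝ) (gradient g x)]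
    refine Finset.sum_congr rfl fun i _ => ?_
    rw [OrthonormalBasis.repr_apply_apply, real_inner_comm, inner_gradient_left]
    simp [pd]
  rw [h, map_sum]
  simp [pd]

lemma hess_sum {d : ℕ} {U : EuclideanSpace ℝ (Fin d) → ℝ} (hU : ContDiff ℝ 2 U)
    (u : EuclideanSpace ℝ (Fin d) → ℝ) (x) :
    fderiv ℝ (fun y => fderiv ℝ U y (gradient u x)) x (gradient u x)
      = ∑ j, ∑ i, pd j u x * (pd j (pd i U) x * pd i u x) := by
  rw [fderiv_eq_sum]
  refine Finset.sum_congr rfl fun j _ => ?_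
  rw [← Finset.mul_sum]
  congr 1
  have : (fun y => fderiv ℝ U y (gradient u x)) = fun y => ∑ i, pd i u x * pd i U y := by
    funext y; exact fderiv_eq_sum U u x y
  rw [this]
  unfold pd
  have hd : ∀ i : Fin d, DifferentiableAt ℝ (fun y => fderiv ℝ U y (EuclideanSpace.single i 1)) x :=
    fun i => (pd_contDiff i (m := 1) hU (by norm_num)).differentiable (by norm_num) x
  rw [fderiv_fun_sum (fun i _ => (hd i).const_mul _)]
  simp only [_root_.sum_apply]
  refine Finset.sum_congr rfl fun i _ => ?_
  rw [fderiv_const_mul (hd i)]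
  simp; ring

lemma exists_cutoff (d : ℕ) (R δ : ℝ) (hδ : 0 < δ) :
    ∃ η : EuclideanSpace ℝ (Fin d) → ℝ, ContDiff ℝ 2 η ∧ HasCompactSupport η ∧
      (∀ x, 0 ≤ η x ∧ η x ≤ 1) ∧ (∀ x, ‖x‖ ≤ R → η x = 1) ∧ ∀ i x, |pd i η x| ≤ δ := by
  let f : ContDiffBump (0 : EuclideanSpace ℝ (Fin d)) := ⟨1, 2, by norm_num, by norm_num⟩
  have hf : ContDiff ℝ 2 f := f.contDiff
  obtain ⟨C, hC⟩ := (hf.fderiv_right (m := 0) (by norm_num)).continuous.bounded_above_of_compact_support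
    (f.hasCompactSupport.fderiv (𝕜 := ℝ))
  have hC0 : 0 ≤ C := (norm_nonneg _).trans (hC 0)
  obtain ⟨t, ht0, htR, htC⟩ : ∃ t : ℝ, 0 < t ∧ t * R ≤ 1 ∧ C * t ≤ δ := by
    refine ⟨min (1 / (|R| + 1)) (δ / (C + 1)), by positivity, ?_, ?_⟩
    · calc _ ≤ min (1 / (|R| + 1)) (δ / (C + 1)) * (|R| + 1) := by
            gcongr; linarith [le_abs_self R]
        _ ≤ 1 / (|R| + 1) * (|R| + 1) := by gcongr; exact min_le_left _ _
        _ = 1 := by field_simp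
    · calc _ ≤ (C + 1) * min (1 / (|R| + 1)) (δ / (C + 1)) := by gcongr; linarith
        _ ≤ (C + 1) * (δ / (C + 1)) := by gcongr; exact min_le_right _ _
        _ = δ := by field_simp
  refine ⟨fun x => f (t • x), hf.comp (contDiff_const_smul t), ?_, ?_, ?_, ?_⟩
  · exact f.hasCompactSupport.comp_homeomorph (Homeomorph.smulOfNeZero t ht0.ne')
  · exact fun x => ⟨f.nonneg, f.le_one⟩
  · intro x hx
    apply f.one_of_mem_closedBall
    simp only [mem_closedBall_zero_iff, norm_smul, Real.norm_eq_abs, abs_of_pos ht0]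
    exact (mul_le_mul_of_nonneg_left hx ht0.le).trans htR
  · intro i x
    have h1 : pd i (fun x => f (t • x)) x = t * fderiv ℝ f (t • x) (EuclideanSpace.single i 1) := by
      unfold pd
      have hd : DifferentiableAt ℝ f (t • x) := hf.differentiable (by norm_num) _
      have := (hd.hasFDerivAt.comp x ((hasFDerivAt_id x).const_smul t)).fderiv
      have h2 : (fun x => f (t • x)) = (f : _ → ℝ) ∘ (HSMul.hSMul t) := rfl
      rw [h2, this]
      simp
    rw [h1, abs_mul, abs_of_pos ht0]
    have := (fderiv ℝ f (t • x)).le_opNorm (EuclideanSpace.single i 1)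
    simp at this
    calc _ ≤ t * C := by gcongr; exact this.trans (hC _)
      _ ≤ δ := by linarith

lemma algebra_core {d : ℕ} (W e c δ g u : ℝ) (E p q G : Fin d → ℝ) (h H t : Fin d → Fin d → ℝ)
    (hW : 0 ≤ W) (he0 : 0 ≤ e) (he1 : e ≤ 1) (hc : 0 ≤ c) (hE : ∀ i, |E i| ≤ δ)
    (hG : ∀ j, e ^ 2 * G j = G j)
    (h1 : ∀ j, p j - ∑ i, t i j + ∑ i, (H j i * p i + q i * h i j) = G j)
    (h2 : u - ∑ i, h i i + ∑ i, q i * p i = g)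
    (hH : -c * ∑ i, p i ^ 2 ≤ ∑ j, ∑ i, p j * (H j i * p i)) :
    1 / 2 * (W * (e ^ 2 * ∑ i, ∑ j, h i j ^ 2)) ≤
      (∑ i, ∑ j, W * (-q i * e ^ 2 * p j * h i j + 2 * e * E i * p j * h i j
        + e ^ 2 * h i j ^ 2 + e ^ 2 * p j * t i j))
      + (∑ i, W * (-q i * g * p i + G i * p i + g * h i i))
      + W * ((2 * d * δ ^ 2 + c) * ∑ i, p i ^ 2 + 3 / 2 * g ^ 2 + 1 / 2 * u ^ 2) := by
  have e1 : (∑ i, ∑ j, W * (-q i * e ^ 2 * p j * h i j + 2 * e * E i * p j * h i j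
        + e ^ 2 * h i j ^ 2 + e ^ 2 * p j * t i j))
      = W * ((∑ i, ∑ j, (2 * e * E i * p j * h i j + e ^ 2 * h i j ^ 2))
        + e ^ 2 * ∑ j, p j * (∑ i, (t i j - q i * h i j))) := by
    rw [show (∑ j, p j * (∑ i, (t i j - q i * h i j)))
        = ∑ i, ∑ j, p j * (t i j - q i * h i j) by
      simp only [Finset.mul_sum]; exact Finset.sum_comm]
    simp only [Finset.mul_sum, ← Finset.sum_add_distrib]
    refine Finset.sum_congr rfl fun i _ => Finset.sum_congr rfl fun j _ => by ring
  have e2 : ∀ j, (∑ i, (t i j - q i * h i j)) = p j + (∑ i, H j i * p i) - G j := by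
    intro j
    have := h1 j
    rw [Finset.sum_add_distrib] at this
    rw [Finset.sum_sub_distrib]; linarith
  have e3 : e ^ 2 * ∑ j, p j * (∑ i, (t i j - q i * h i j))
      = e ^ 2 * (∑ j, p j ^ 2) + e ^ 2 * (∑ j, ∑ i, p j * (H j i * p i)) - ∑ j, G j * p j := by
    rw [← mul_add, ← Finset.sum_add_distrib, Finset.mul_sum, Finset.mul_sum, ← Finset.sum_sub_distrib]
    refine Finset.sum_congr rfl fun j _ => ?_
    rw [e2, ← Finset.mul_sum]
    linear_combination (- p j) * hG j
  have e4 : (∑ i, W * (-q i * g * p i + G i * p i + g * h i i))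
      = W * (g * (u - g) + ∑ j, G j * p j) := by
    have : u - g = (∑ i, h i i) - ∑ i, q i * p i := by linarith
    rw [this, ← Finset.sum_sub_distrib, Finset.mul_sum, ← Finset.sum_add_distrib, Finset.mul_sum]
    refine Finset.sum_congr rfl fun j _ => by ring
  have e5 : (1 / 2 * (e ^ 2 * ∑ i, ∑ j, h i j ^ 2)) - 2 * d * δ ^ 2 * ∑ j, p j ^ 2 ≤
      ∑ i, ∑ j, (2 * e * E i * p j * h i j + e ^ 2 * h i j ^ 2) := by
    have : 2 * d * δ ^ 2 * ∑ j, p j ^ 2 = ∑ i : Fin d, ∑ j, 2 * δ ^ 2 * p j ^ 2 := by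
      simp [Finset.mul_sum]
      refine Finset.sum_congr rfl fun j _ => by ring
    rw [this]
    simp only [Finset.mul_sum, ← Finset.sum_sub_distrib]
    refine Finset.sum_le_sum fun i _ => Finset.sum_le_sum fun j _ => ?_
    have hE2 : E i ^ 2 ≤ δ ^ 2 := sq_le_sq' (abs_le.1 (hE i)).1 (abs_le.1 (hE i)).2
    nlinarith [sq_nonneg (e * h i j + 2 * E i * p j), mul_le_mul_of_nonneg_right hE2 (sq_nonneg (p j))]
  have hP : 0 ≤ ∑ j, p j ^ 2 := Finset.sum_nonneg fun j _ => sq_nonneg _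
  have he2 : e ^ 2 ≤ 1 := by nlinarith
  have e6 : -c * ∑ i, p i ^ 2 ≤ e ^ 2 * (∑ j, ∑ i, p j * (H j i * p i)) := by
    nlinarith [mul_le_mul_of_nonneg_left hH (sq_nonneg e), mul_nonneg hc hP,
      mul_nonneg (sub_nonneg.2 he2) (mul_nonneg hc hP)]
  rw [e1, e3, e4, ← mul_add, ← mul_add, mul_left_comm]
  refine mul_le_mul_of_nonneg_left ?_ hW
  nlinarith [mul_nonneg (sq_nonneg e) hP, sq_nonneg (g + u)]

lemma cutoff_bound {d : ℕ} {U w g u η : EuclideanSpace ℝ (Fin d) → ℝ} {c δ : ℝ}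
    (hU : ContDiff ℝ 2 U) (hw : ContDiff ℝ 2 w) (hw0 : ∀ x, 0 ≤ w x)
    (hwU : ∀ i x, pd i w x = - w x * pd i U x) (hc : 0 ≤ c)
    (hH : ∀ x, -c * ∑ i, pd i u x ^ 2 ≤ ∑ j, ∑ i, pd j u x * (pd j (pd i U) x * pd i u x))
    (hg : ContDiff ℝ 2 g) (hgc : HasCompactSupport g) (hu : ContDiff ℝ 3 u)
    (hP : ∀ x, u x - ∑ i, pd i (pd i u) x + ∑ i, pd i U x * pd i u x = g x)
    (hη : ContDiff ℝ 2 η) (hηc : HasCompactSupport η) (hη01 : ∀ x, 0 ≤ η x ∧ η x ≤ 1)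
    (hηg : ∀ x ∈ tsupport g, η x = 1) (hηδ : ∀ i x, |pd i η x| ≤ δ)
    (hiu : Integrable (fun x => w x * u x ^ 2))
    (hu2 : ∫ x, w x * u x ^ 2 ≤ ∫ x, w x * g x ^ 2)
    (hip : Integrable (fun x => w x * ∑ i, pd i u x ^ 2))
    (hp2 : ∫ x, w x * ∑ i, pd i u x ^ 2 ≤ ∫ x, w x * g x ^ 2) :
    Integrable (fun x => w x * (η x ^ 2 * ∑ i, ∑ j, pd i (pd j u) x ^ 2)) ∧
    ∫ x, w x * (η x ^ 2 * ∑ i, ∑ j, pd i (pd j u) x ^ 2)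
      ≤ 2 * (2 + c + 2 * d * δ ^ 2) * ∫ x, w x * g x ^ 2 := by
  have hU1 : ∀ i, ContDiff ℝ 1 (pd i U) := fun i => pd_contDiff i hU (by norm_num)
  have hp : ∀ i, ContDiff ℝ 2 (pd i u) := fun i => pd_contDiff i hu (by norm_num)
  have hp1 : ∀ i, ContDiff ℝ 1 (pd i u) := fun i => (hp i).of_le (by norm_num)
  have hh : ∀ i j, ContDiff ℝ 1 (pd i (pd j u)) := fun i j => pd_contDiff i (hp j) (by norm_num)
  have hu2' : ContDiff ℝ 2 u := hu.of_le (by norm_num)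
  have hw1 : ContDiff ℝ 1 w := hw.of_le (by norm_num)
  have hη1 : ContDiff ℝ 1 η := hη.of_le (by norm_num)
  have hg1 : ContDiff ℝ 1 g := hg.of_le (by norm_num)
  have hu1 : ContDiff ℝ 1 u := hu.of_le (by norm_num)
  have hE : ∀ x j, pd j u x - ∑ i, pd i (pd i (pd j u)) x
      + ∑ i, (pd j (pd i U) x * pd i u x + pd i U x * pd i (pd j u) x) = pd j g x := by
    intro x j
    have hfun : g = fun x => u x - ∑ i, pd i (pd i u) x + ∑ i, pd i U x * pd i u x := by
      funext x; exact (hP x).symm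
    have dif : ∀ {f : EuclideanSpace ℝ (Fin d) → ℝ}, ContDiff ℝ 1 f → DifferentiableAt ℝ f x :=
      fun hf => hf.differentiable (by norm_num) x
    have hprod : ∀ i, ContDiff ℝ 1 (fun x => pd i U x * pd i u x) := fun i => (hU1 i).mul (hp1 i)
    have h3 : pd j g x = pd j u x - ∑ i, pd j (pd i (pd i u)) x
        + ∑ i, pd j (fun x => pd i U x * pd i u x) x := by
      rw [show pd j g x = fderiv ℝ g x (EuclideanSpace.single j 1) from rfl, hfun]
      rw [fderiv_fun_add ((dif hu1).fun_sub (DifferentiableAt.fun_sum fun i _ => dif (hh i i)))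
        (DifferentiableAt.fun_sum fun i _ => dif (hprod i)),
        fderiv_fun_sub (dif hu1) (DifferentiableAt.fun_sum fun i _ => dif (hh i i)),
        fderiv_fun_sum (fun i _ => dif (hh i i)), fderiv_fun_sum (fun i _ => dif (hprod i))]
      simp [pd]
    rw [h3]
    congr 1
    · congr 1
      refine Finset.sum_congr rfl fun i _ => ?_
      rw [pd_symm j i (hp i), pd_symm j i hu2']
    · refine Finset.sum_congr rfl fun i _ => ?_
      rw [pd_mul j (hU1 i) (hp1 i), pd_symm j i hu2']
  let F : Fin d → Fin d → EuclideanSpace ℝ (Fin d) → ℝ :=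
    fun i j y => w y * (η y * (η y * (pd j u y * pd i (pd j u) y)))
  let K : Fin d → EuclideanSpace ℝ (Fin d) → ℝ := fun i y => w y * (g y * pd i u y)
  have hFs : ∀ i j, ContDiff ℝ 1 (F i j) := fun i j =>
    hw1.mul (hη1.mul (hη1.mul ((hp1 j).mul (hh i j))))
  have hKs : ∀ i, ContDiff ℝ 1 (K i) := fun i => hw1.mul (hg1.mul (hp1 i))
  have hFc : ∀ i j, HasCompactSupport (F i j) := fun i j =>
    HasCompactSupport.mul_left (f := w) (HasCompactSupport.mul_right hηc)
  have hKc : ∀ i, HasCompactSupport (K i) := fun i =>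
    HasCompactSupport.mul_left (f := w) (HasCompactSupport.mul_right hgc)
  have hFd : ∀ i j x, pd i (F i j) x = w x * (-pd i U x * η x ^ 2 * pd j u x * pd i (pd j u) x
      + 2 * η x * pd i η x * pd j u x * pd i (pd j u) x
        + η x ^ 2 * pd i (pd j u) x ^ 2 + η x ^ 2 * pd j u x * pd i (pd i (pd j u)) x) := by
    intro i j x
    rw [pd_mul i hw1 (hη1.mul (hη1.mul ((hp1 j).mul (hh i j)))),
      pd_mul i hη1 (hη1.mul ((hp1 j).mul (hh i j))), pd_mul i hη1 ((hp1 j).mul (hh i j)),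
      pd_mul i (hp1 j) (hh i j), hwU]
    ring
  have hKd : ∀ i x, pd i (K i) x = w x * (-pd i U x * g x * pd i u x + pd i g x * pd i u x
      + g x * pd i (pd i u) x) := by
    intro i x
    rw [pd_mul i hw1 (hg1.mul (hp1 i)), pd_mul i hg1 (hp1 i), hwU]
    ring
  have hGj : ∀ x j, η x ^ 2 * pd j g x = pd j g x := by
    intro x j
    by_cases hx : x ∈ tsupport g
    · simp [hηg x hx]
    · have : fderiv ℝ g x = 0 := by
        by_contra h
        exact hx (support_fderiv_subset ℝ h)
      simp [pd, this]
  have key : ∀ x, 1 / 2 * (w x * (η x ^ 2 * ∑ i, ∑ j, pd i (pd j u) x ^ 2)) ≤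
      (∑ i, ∑ j, pd i (F i j) x) + (∑ i, pd i (K i) x)
      + ((2 * d * δ ^ 2 + c) * (w x * ∑ i, pd i u x ^ 2) + 3 / 2 * (w x * g x ^ 2)
        + 1 / 2 * (w x * u x ^ 2)) := by
    intro x
    have := algebra_core (w x) (η x) c δ (g x) (u x) (fun i => pd i η x) (fun i => pd i u x)
      (fun i => pd i U x) (fun i => pd i g x) (fun i j => pd i (pd j u) x)
      (fun i j => pd i (pd j U) x) (fun i j => pd i (pd i (pd j u)) x)
      (hw0 x) (hη01 x).1 (hη01 x).2 hc (fun i => hηδ i x) (hGj x) (hE x) (hP x) (hH x)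
    simp only [hFd, hKd]
    refine this.trans (le_of_eq ?_)
    ring
  have hig : Integrable (fun x => w x * g x ^ 2) := by
    refine Continuous.integrable_of_hasCompactSupport (hw.continuous.mul (hg.continuous.pow 2)) ?_
    change HasCompactSupport (fun x => w x * g x ^ 2)
    have : (fun x => w x * g x ^ 2) = fun x => w x * (g x * g x) := by funext x; ring
    rw [this]
    exact HasCompactSupport.mul_left (f := w) (HasCompactSupport.mul_right hgc)
  have hiL : Integrable (fun x => w x * (η x ^ 2 * ∑ i, ∑ j, pd i (pd j u) x ^ 2)) := by
    refine Continuous.integrable_of_hasCompactSupport ?_ ?_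
    · refine hw.continuous.mul ((hη.continuous.pow 2).mul ?_)
      exact continuous_finsetSum _ fun i _ => continuous_finsetSum _ fun j _ => (hh i j).continuous.pow 2
    · simp only [pow_two (η _), mul_assoc]
      exact HasCompactSupport.mul_left (f := w) (HasCompactSupport.mul_right hηc)
  refine ⟨hiL, ?_⟩
  have hiF : Integrable (fun x => ∑ i, ∑ j, pd i (F i j) x) :=
    integrable_finsetSum _ fun i _ => integrable_finsetSum _ fun j _ =>
      (pd_integral i (hFs i j) (hFc i j)).1
  have hiK : Integrable (fun x => ∑ i, pd i (K i) x) :=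
    integrable_finsetSum _ fun i _ => (pd_integral i (hKs i) (hKc i)).1
  have hF0 : ∫ x, ∑ i, ∑ j, pd i (F i j) x = 0 := by
    rw [integral_finsetSum _ fun i _ => integrable_finsetSum _ fun j _ =>
      (pd_integral i (hFs i j) (hFc i j)).1]
    refine Finset.sum_eq_zero fun i _ => ?_
    rw [integral_finsetSum _ fun j _ => (pd_integral i (hFs i j) (hFc i j)).1]
    exact Finset.sum_eq_zero fun j _ => (pd_integral i (hFs i j) (hFc i j)).2
  have hK0 : ∫ x, ∑ i, pd i (K i) x = 0 := by
    rw [integral_finsetSum _ fun i _ => (pd_integral i (hKs i) (hKc i)).1]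
    exact Finset.sum_eq_zero fun i _ => (pd_integral i (hKs i) (hKc i)).2
  have hmono := integral_mono (hiL.const_mul (1 / 2))
    ((hiF.add hiK).add (((hip.const_mul (2 * d * δ ^ 2 + c)).add (hig.const_mul (3 / 2))).add
      (hiu.const_mul (1 / 2)))) key
  rw [integral_const_mul, integral_add' (hiF.add hiK) (((hip.const_mul _).add (hig.const_mul _)).add
      (hiu.const_mul _)), integral_add' hiF hiK, integral_add' ((hip.const_mul _).add (hig.const_mul _))
      (hiu.const_mul _), integral_add' (hip.const_mul _) (hig.const_mul _), hF0, hK0,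
      integral_const_mul, integral_const_mul, integral_const_mul] at hmono
  have : (2 * d * δ ^ 2 + c) * (∫ x, w x * ∑ i, pd i u x ^ 2)
      ≤ (2 * d * δ ^ 2 + c) * ∫ x, w x * g x ^ 2 := mul_le_mul_of_nonneg_left hp2 (by positivity)
  linarith

lemma lint_gibbs {d : ℕ} {U f : EuclideanSpace ℝ (Fin d) → ℝ} {Z : ℝ} (hZ : 0 < Z)
    (hU : Continuous U) (hf : Continuous f) (s : Set (EuclideanSpace ℝ (Fin d)))
    (hs : MeasurableSet s) :
    ∫⁻ x in s, ENNReal.ofReal (f x) ∂(gibbs d U Z)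
      = ∫⁻ x in s, ENNReal.ofReal (Real.exp (-U x) / Z * f x) := by
  unfold gibbs
  have hm : Measurable fun x => ENNReal.ofReal (Real.exp (-U x) / Z) :=
    (Continuous.measurable (by fun_prop)).ennreal_ofReal
  rw [restrict_withDensity hs, lintegral_withDensity_eq_lintegral_mul _ hm hf.measurable.ennreal_ofReal]
  refine lintegral_congr fun x => ?_
  rw [Pi.mul_apply, ENNReal.ofReal_mul (by positivity)]

lemma real_of_lint {d : ℕ} {a b : EuclideanSpace ℝ (Fin d) → ℝ} (ha : Continuous a)
    (ha0 : ∀ x, 0 ≤ a x) (hb0 : ∀ x, 0 ≤ b x) (hb : Integrable b)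
    (h : ∫⁻ x, ENNReal.ofReal (a x) ≤ ∫⁻ x, ENNReal.ofReal (b x)) :
    Integrable a ∧ ∫ x, a x ≤ ∫ x, b x := by
  rw [← ofReal_integral_eq_lintegral_ofReal hb (Filter.Eventually.of_forall hb0)] at h
  have hi : Integrable a := by
    refine ⟨ha.aestronglyMeasurable, ?_⟩
    rw [hasFiniteIntegral_iff_ofReal (Filter.Eventually.of_forall ha0)]
    exact h.trans_lt ENNReal.ofReal_lt_top
  refine ⟨hi, ?_⟩
  rw [← ofReal_integral_eq_lintegral_ofReal hi (Filter.Eventually.of_forall ha0)] at h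
  exact (ENNReal.ofReal_le_ofReal_iff (integral_nonneg hb0)).1 h

/-- Second-derivative a priori estimate for the Poisson equation
`u − Δu + ⟨∇U, ∇u⟩ = g`: `∫ ‖∇²u‖_F² dπ ≤ 2(2 + c_U) ∫ g² dπ` (finite in particular). -/
theorem stmt7 (d : ℕ) (hd : 1 ≤ d) (U : EuclideanSpace ℝ (Fin d) → ℝ)
    (hU : ContDiff ℝ 2 U)
    (hIntU : Integrable (fun x => Real.exp (-U x)))
    (Z : ℝ) (hZ : Z = ∫ x, Real.exp (-U x))
    (c_U : ℝ) (hcU : 0 ≤ c_U)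
    (hHessU : ∀ x v : EuclideanSpace ℝ (Fin d),
      -c_U * ‖v‖ ^ 2 ≤ fderiv ℝ (fun y => fderiv ℝ U y v) x v)
    (g : EuclideanSpace ℝ (Fin d) → ℝ)
    (hg : ContDiff ℝ (⊤ : ℕ∞) g) (hgc : HasCompactSupport g)
    (u : EuclideanSpace ℝ (Fin d) → ℝ) (hu : ContDiff ℝ 3 u)
    (hPoisson : ∀ x, u x - lapl d u x + ⟪gradient U x, gradient u x⟫ = g x)
    (hu2 : ∫⁻ x, ENNReal.ofReal ((u x) ^ 2) ∂(gibbs d U Z)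
      ≤ ∫⁻ x, ENNReal.ofReal ((g x) ^ 2) ∂(gibbs d U Z))
    (hgradu2 : ∫⁻ x, ENNReal.ofReal (‖gradient u x‖ ^ 2) ∂(gibbs d U Z)
      ≤ ∫⁻ x, ENNReal.ofReal ((g x) ^ 2) ∂(gibbs d U Z)) :
    ∫⁻ x, ENNReal.ofReal (hessFS d u x) ∂(gibbs d U Z)
      ≤ ENNReal.ofReal (2 * (2 + c_U))
          * ∫⁻ x, ENNReal.ofReal ((g x) ^ 2) ∂(gibbs d U Z) := by
  have hZ0 : 0 < Z := by rw [hZ]; exact integral_exp_pos hIntU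
  set w : EuclideanSpace ℝ (Fin d) → ℝ := fun x => Real.exp (-U x) / Z with hwdef
  have hw : ContDiff ℝ 2 w := hU.neg.exp.div_const Z
  have hw0 : ∀ x, 0 ≤ w x := fun x => by positivity
  have hwU : ∀ i x, pd i w x = - w x * pd i U x := by
    intro i x
    have hd : HasFDerivAt U (fderiv ℝ U x) x := (hU.differentiable (by norm_num) x).hasFDerivAt
    have h1 := (hd.neg.exp.mul_const (Z⁻¹)).fderiv
    have h2 : w = fun y => Real.exp (-U y) * Z⁻¹ := by funext y; simp [hwdef, div_eq_mul_inv]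
    unfold pd
    have h3 : fderiv ℝ w x = Z⁻¹ • Real.exp (-U x) • -fderiv ℝ U x := by rw [h2]; exact h1
    rw [h3, h2]
    simp; ring
  have hH : ∀ x, -c_U * ∑ i, pd i u x ^ 2 ≤
      ∑ j, ∑ i, pd j u x * (pd j (pd i U) x * pd i u x) := by
    intro x
    rw [← hess_sum hU, ← norm_grad]
    exact hHessU x _
  have hg2 : ContDiff ℝ 2 g := hg.of_le (WithTop.coe_le_coe.2 (le_top : (2 : ℕ∞) ≤ ⊤))
  have hP : ∀ x, u x - ∑ i, pd i (pd i u) x + ∑ i, pd i U x * pd i u x = g x := by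
    intro x
    rw [← inner_grad]; exact hPoisson x
  have hp : ∀ i, ContDiff ℝ 2 (pd i u) := fun i => pd_contDiff i hu (by norm_num)
  have hhc : Continuous (hessFS d u) := by
    refine continuous_finsetSum _ fun i _ => continuous_finsetSum _ fun j _ => ?_
    exact ((pd_contDiff i (m := 1) (hp j) (by norm_num)).continuous).pow 2
  have hh0 : ∀ x, 0 ≤ hessFS d u x := fun x =>
    Finset.sum_nonneg fun i _ => Finset.sum_nonneg fun j _ => sq_nonneg _
  have hpc : Continuous fun x => ∑ i, pd i u x ^ 2 :=
    continuous_finsetSum _ fun i _ => (hp i).continuous.pow 2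
  have conv : ∀ f : EuclideanSpace ℝ (Fin d) → ℝ, Continuous f →
      ∫⁻ x, ENNReal.ofReal (f x) ∂(gibbs d U Z) = ∫⁻ x, ENNReal.ofReal (w x * f x) := by
    intro f hf
    simpa using lint_gibbs hZ0 hU.continuous hf Set.univ MeasurableSet.univ
  have hwg0 : ∀ x, 0 ≤ w x * g x ^ 2 := fun x => mul_nonneg (hw0 x) (sq_nonneg _)
  have hig : Integrable (fun x => w x * g x ^ 2) := by
    refine Continuous.integrable_of_hasCompactSupport (hw.continuous.mul (hg.continuous.pow 2)) ?_
    change HasCompactSupport (fun x => w x * g x ^ 2)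
    have : (fun x => w x * g x ^ 2) = fun x => w x * (g x * g x) := by funext x; ring
    rw [this]
    exact HasCompactSupport.mul_left (f := w) (HasCompactSupport.mul_right hgc)
  simp only [norm_grad] at hgradu2
  have hG := conv (fun x => g x ^ 2) (hg.continuous.pow 2)
  rw [hG, conv (fun x => u x ^ 2) (hu.continuous.pow 2)] at hu2
  rw [hG, conv _ hpc] at hgradu2
  obtain ⟨hiu, hu2'⟩ := real_of_lint (hw.continuous.mul (hu.continuous.pow 2))
    (fun x => mul_nonneg (hw0 x) (sq_nonneg _)) hwg0 hig hu2
  obtain ⟨hip, hp2'⟩ := real_of_lint (hw.continuous.mul hpc)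
    (fun x => mul_nonneg (hw0 x) (Finset.sum_nonneg fun i _ => sq_nonneg _)) hwg0 hig hgradu2
  rw [hG, ← ofReal_integral_eq_lintegral_ofReal hig (Filter.Eventually.of_forall hwg0),
    ← ENNReal.ofReal_mul (by positivity)]
  set I := ∫ x, w x * g x ^ 2 with hI
  obtain ⟨R, hR⟩ := hgc.isCompact.isBounded.subset_closedBall 0
  have bound : ∀ (n : ℕ) (δ : ℝ), 0 < δ →
      ∫⁻ x in Metric.closedBall (0 : EuclideanSpace ℝ (Fin d)) n,
        ENNReal.ofReal (hessFS d u x) ∂(gibbs d U Z)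
      ≤ ENNReal.ofReal (2 * (2 + c_U + 2 * d * δ ^ 2) * I) := by
    intro n δ hδ
    obtain ⟨η, hη, hηc, hη01, hη1, hηδ⟩ := exists_cutoff d (max n R) δ hδ
    obtain ⟨hi, hle⟩ := cutoff_bound hU hw hw0 hwU hcU hH hg2 hgc hu hP hη hηc hη01
      (fun x hx => hη1 x ((by simpa using hR hx : ‖x‖ ≤ R).trans (le_max_right _ _))) hηδ
      hiu hu2' hip hp2'
    refine le_trans ?_ (ENNReal.ofReal_le_ofReal hle)
    have hn : ∀ x, 0 ≤ w x * (η x ^ 2 * ∑ i, ∑ j, pd i (pd j u) x ^ 2) := fun x =>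
      mul_nonneg (hw0 x) (mul_nonneg (sq_nonneg _) (hh0 x))
    rw [ofReal_integral_eq_lintegral_ofReal hi (Filter.Eventually.of_forall hn),
      lint_gibbs hZ0 hU.continuous hhc _ measurableSet_closedBall]
    refine le_trans ?_ (setLIntegral_le_lintegral (Metric.closedBall 0 n) _)
    refine setLIntegral_mono' measurableSet_closedBall fun x hx => ?_
    have hx1 : η x = 1 := hη1 x ((by simpa using hx : ‖x‖ ≤ n).trans (le_max_left _ _))
    rw [hx1]
    simp [hessFS, pd, hwdef]
    rfl
  have bound' : ∀ n : ℕ, ∫⁻ x in Metric.closedBall (0 : EuclideanSpace ℝ (Fin d)) n,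
        ENNReal.ofReal (hessFS d u x) ∂(gibbs d U Z) ≤ ENNReal.ofReal (2 * (2 + c_U) * I) := by
    intro n
    have ht : Filter.Tendsto (fun δ : ℝ => ENNReal.ofReal (2 * (2 + c_U + 2 * d * δ ^ 2) * I))
        (nhdsWithin 0 (Set.Ioi 0)) (nhds (ENNReal.ofReal (2 * (2 + c_U) * I))) := by
      have hc : Continuous fun δ : ℝ => ENNReal.ofReal (2 * (2 + c_U + 2 * d * δ ^ 2) * I) := by
        exact ENNReal.continuous_ofReal.comp (by fun_prop)
      have := (hc.tendsto 0).mono_left (nhdsWithin_le_nhds (s := Set.Ioi 0))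
      simpa using this
    exact ge_of_tendsto ht (Filter.eventually_of_mem self_mem_nhdsWithin fun δ hδ => bound n δ hδ)
  have huniv : (⋃ n : ℕ, Metric.closedBall (0 : EuclideanSpace ℝ (Fin d)) n) = Set.univ :=
    Metric.iUnion_closedBall_nat 0
  rw [← setLIntegral_univ, ← huniv, setLIntegral_iUnion_of_directed]
  · exact iSup_le bound'
  · exact Monotone.directed_le fun a b hab => Metric.closedBall_subset_closedBall (by exact_mod_cast hab)
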